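/- For every n ≥ 1 and every S ⊆ [n], the following identity of polynomials in t holds, where r = n − |S|: Σ_{S ⊆ T ⊆ [n]} (−1)^{n−|T|} ψ_t(T) equals 0 if 1 ∉ S; equals 0 if [n]∖S contains two consecutive integers; equals t^r(1+t)^{n−1−2r} if [n]∖S contains no two consecutive integers and 1, n ∈ S; and equals t^r(1+t)^{n−2r} if [n]∖S contains no two consecutive integers, 1 ∈ S and n ∉ S. -/

import Mathlib

/-!
STATEMENT 5: For every n ≥ 1 and every S ⊆ [n], with r = n − |S|:
Σ_{S ⊆ T ⊆ [n]} (−1)^{n−|T|} ψ_t(T) equals 0 if 1 ∉ S; equals 0 if [n]∖S contains two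
consecutive integers; equals t^r(1+t)^{n−1−2r} if [n]∖S is stable and 1, n ∈ S; and equals
t^r(1+t)^{n−2r} if [n]∖S is stable, 1 ∈ S and n ∉ S.
-/

noncomputable section

/-- `[m]_t = 1 + t + ⋯ + t^{m-1}` as a polynomial in the indeterminate `t` over `ℤ`. -/
def qt (m : ℕ) : Polynomial ℤ := ∑ i ∈ Finset.range m, Polynomial.X ^ i

/-- Helper: given the previous element `prev` and the (sorted, increasing) list of remaining
elements `s₁ < s₂ < ⋯`, returns `[s₁ - prev + 1]_t [s₂ - s₁ + 1]_t ⋯`. -/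
def phiAux : ℕ → List ℕ → Polynomial ℤ
  | _, [] => 1
  | prev, s :: rest => qt (s - prev + 1) * phiAux s rest

/-- `ψ_t(T) = [s₁]_t [s₂−s₁+1]_t ⋯ [s_k−s_{k−1}+1]_t` for `T = {s₁ < s₂ < ⋯ < s_k}`,
with `ψ_t(∅) = 1`. -/
def psi (T : Finset ℕ) : Polynomial ℤ :=
  match T.sort (· ≤ ·) with
  | [] => 1
  | s :: rest => qt s * phiAux s rest

lemma qt_zero : qt 0 = 0 := by simp [qt]

lemma qt_one : qt 1 = 1 := by simp [qt]

lemma qt_succ (m : ℕ) : qt (m + 1) = 1 + Polynomial.X * qt m := by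
  simp [qt, Finset.sum_range_succ', Finset.mul_sum, pow_succ', add_comm]

/-- The signed sum of `phiAux p` over the sets `T` with `S ∩ [c, c + m) ⊆ T ⊆ [c, c + m)`,
computed by deciding the membership of `c`, `c + 1`, … in turn. -/
def signedSum (S : Finset ℕ) : ℕ → ℕ → ℕ → Polynomial ℤ
  | 0, _, _ => 1
  | m + 1, p, c =>
    qt (c - p + 1) * signedSum S m c (c + 1) - if c ∈ S then 0 else signedSum S m p (c + 1)

lemma phiAux_sort_insert {p c : ℕ} {T : Finset ℕ} (h : ∀ x ∈ T, c < x) :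
    phiAux p ((insert c T).sort (· ≤ ·)) = qt (c - p + 1) * phiAux c (T.sort (· ≤ ·)) := by
  rw [Finset.sort_insert (r := (· ≤ ·)) (fun x hx => (h x hx).le)
    (fun hc => lt_irrefl c (h c hc)), phiAux]

lemma psi_eq_phiAux {T : Finset ℕ} (h : ∀ x ∈ T, 1 ≤ x) :
    psi T = phiAux 1 (T.sort (· ≤ ·)) := by
  unfold psi
  have h' : ∀ x ∈ T.sort (· ≤ ·), 1 ≤ x := fun x hx => h x ((Finset.mem_sort _).1 hx)
  cases hT : T.sort (· ≤ ·) with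
  | nil => rfl
  | cons s rest =>
    have : 1 ≤ s := h' s (by simp [hT])
    simp only [phiAux]
    rw [Nat.sub_add_cancel this]

lemma sum_prod_phiAux_eq_signedSum (S : Finset ℕ) (m p c : ℕ) :
    ∑ T ∈ (Finset.Ico c (c + m)).powerset,
      (∏ x ∈ Finset.Ico c (c + m) \ T, if x ∈ S then (0 : Polynomial ℤ) else -1) *
        phiAux p (T.sort (· ≤ ·)) = signedSum S m p c := by
  induction m generalizing p c with
  | zero => simp [signedSum, phiAux]
  | succ m ih =>
    have hI : Finset.Ico c (c + (m + 1)) = insert c (Finset.Ico (c + 1) (c + 1 + m)) := by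
      ext x; simp only [Finset.mem_Ico, Finset.mem_insert]; omega
    have hc : c ∉ Finset.Ico (c + 1) (c + 1 + m) := by simp
    rw [hI, Finset.sum_powerset_insert hc, signedSum, ← ih c, ← ih p, add_comm, sub_eq_add_neg,
      Finset.mul_sum]
    congr 1
    · refine Finset.sum_congr rfl fun T hT => ?_
      have hT' := Finset.mem_powerset.1 hT
      rw [phiAux_sort_insert fun x hx => (Finset.mem_Ico.1 (hT' hx)).1,
        Finset.insert_sdiff_insert, Finset.sdiff_insert_of_notMem hc]
      ring
    · have : ∀ T ∈ (Finset.Ico (c + 1) (c + 1 + m)).powerset,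
          (∏ x ∈ insert c (Finset.Ico (c + 1) (c + 1 + m)) \ T,
            if x ∈ S then (0 : Polynomial ℤ) else -1) * phiAux p (T.sort (· ≤ ·)) =
          (if c ∈ S then 0 else -1) * ((∏ x ∈ Finset.Ico (c + 1) (c + 1 + m) \ T,
            if x ∈ S then (0 : Polynomial ℤ) else -1) * phiAux p (T.sort (· ≤ ·))) := by
        intro T hT
        have hT' := Finset.mem_powerset.1 hT
        rw [Finset.insert_sdiff_of_notMem _ fun h => hc (hT' h), Finset.prod_insert (by simp),
          mul_assoc]
      rw [Finset.sum_congr rfl this, ← Finset.mul_sum]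
      split_ifs <;> simp

lemma sum_psi_eq_signedSum (n : ℕ) (S : Finset ℕ) (hS : S ⊆ Finset.Icc 1 n) :
    ∑ T ∈ (Finset.Icc 1 n).powerset.filter (fun T => S ⊆ T),
      (-1 : Polynomial ℤ) ^ (n - T.card) * psi T = signedSum S n 1 1 := by
  have hI : Finset.Icc 1 n = Finset.Ico 1 (1 + n) := by
    ext x; simp only [Finset.mem_Icc, Finset.mem_Ico]; omega
  rw [← sum_prod_phiAux_eq_signedSum, ← hI, Finset.sum_filter]
  refine Finset.sum_congr rfl fun T hT => ?_
  have hT' := Finset.mem_powerset.1 hT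
  rw [psi_eq_phiAux fun x hx => (Finset.mem_Icc.1 (hT' hx)).1]
  split_ifs with h
  · congr 1
    rw [Finset.prod_congr rfl (g := fun _ => -1), Finset.prod_const, Finset.card_sdiff_of_subset hT',
      Nat.card_Icc, Nat.add_sub_cancel]
    intro x hx
    exact if_neg fun hxS => (Finset.mem_sdiff.1 hx).2 (h hxS)
  · obtain ⟨x, hxS, hxT⟩ := Finset.not_subset.1 h
    have hx : x ∈ Finset.Icc 1 n \ T := Finset.mem_sdiff.2 ⟨hS hxS, hxT⟩
    have hprod : (∏ y ∈ Finset.Icc 1 n \ T, if y ∈ S then (0 : Polynomial ℤ) else -1) = 0 :=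
      Finset.prod_eq_zero hx (if_pos hxS)
    rw [hprod, zero_mul]

lemma signedSum_of_mem {S : Finset ℕ} {m p c : ℕ} (h : c ∈ S) :
    signedSum S (m + 1) p c = qt (c - p + 1) * signedSum S m c (c + 1) := by
  simp [signedSum, h]

lemma signedSum_of_notMem {S : Finset ℕ} {m p c : ℕ} (h : c ∉ S) :
    signedSum S (m + 1) p c =
      qt (c - p + 1) * signedSum S m c (c + 1) - signedSum S m p (c + 1) := by
  simp [signedSum, h]

lemma signedSum_one_of_notMem {S : Finset ℕ} {p c : ℕ} (h : c ∉ S) :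
    signedSum S 1 p c = Polynomial.X * qt (c - p) := by
  rw [signedSum_of_notMem h, qt_succ]
  simp [signedSum]

lemma signedSum_of_notMem_of_mem {S : Finset ℕ} {m p c : ℕ} (hpc : p ≤ c) (h : c ∉ S)
    (h' : c + 1 ∈ S) :
    signedSum S (m + 2) p c = Polynomial.X * qt (c - p) * signedSum S m (c + 1) (c + 2) := by
  rw [signedSum_of_notMem h, signedSum_of_mem h', signedSum_of_mem h',
    show c + 1 - c = 0 + 1 by omega, show c + 1 - p = c - p + 1 by omega]
  simp only [qt_succ, qt_zero]
  ring

lemma signedSum_of_notMem_of_notMem {S : Finset ℕ} {m p c : ℕ} (hpc : p ≤ c) (h : c ∉ S)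
    (h' : c + 1 ∉ S) : signedSum S (m + 2) p c = 0 := by
  induction m generalizing p c with
  | zero =>
    rw [signedSum_of_notMem h, signedSum_one_of_notMem h', signedSum_one_of_notMem h',
      show c + 1 - c = 0 + 1 by omega, show c + 1 - p = c - p + 1 by omega]
    simp only [qt_succ, qt_zero]
    ring
  | succ m ih =>
    rw [signedSum_of_notMem h]
    by_cases h'' : c + 2 ∈ S
    · rw [signedSum_of_notMem_of_mem (by omega) h' h'', signedSum_of_notMem_of_mem (by omega) h' h'',
        show c + 1 - c = 0 + 1 by omega, show c + 1 - p = c - p + 1 by omega]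
      simp only [qt_succ, qt_zero]
      ring
    · rw [ih (by omega) h' h'', ih (by omega) h' h'', mul_zero, sub_zero]

lemma signedSum_eq_zero {S : Finset ℕ} {m p c i : ℕ} (hpc : p ≤ c) (hci : c ≤ i)
    (him : i + 1 < c + m) (h : i ∉ S) (h' : i + 1 ∉ S) : signedSum S m p c = 0 := by
  induction m generalizing p c with
  | zero => omega
  | succ m ih =>
    rcases hci.eq_or_lt with rfl | hlt
    · obtain ⟨k, rfl⟩ : ∃ k, m = k + 1 := ⟨m - 1, by omega⟩
      exact signedSum_of_notMem_of_notMem hpc h h'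
    · simp [signedSum, ih (p := c) (c := c + 1) (by omega) (by omega) (by omega),
        ih (p := p) (c := c + 1) (by omega) (by omega) (by omega)]

lemma card_Ico_sdiff_of_mem {S : Finset ℕ} {a b : ℕ} (h : a ∈ S) :
    (Finset.Ico a b \ S).card = (Finset.Ico (a + 1) b \ S).card := by
  congr 1
  ext x
  simp only [Finset.mem_sdiff, Finset.mem_Ico]
  have : x ∉ S → x ≠ a := fun hx hxa => hx (hxa ▸ h)
  grind

lemma card_Ico_sdiff_of_notMem {S : Finset ℕ} {a b : ℕ} (hab : a < b) (h : a ∉ S) :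
    (Finset.Ico a b \ S).card = (Finset.Ico (a + 1) b \ S).card + 1 := by
  rw [← Finset.insert_Ico_add_one_left_eq_Ico hab, Finset.insert_sdiff_of_notMem _ h,
    Finset.card_insert_of_notMem (by simp)]

lemma signedSum_of_stable {S : Finset ℕ} {m p : ℕ} (hp : p ∈ S)
    (hS : ∀ i, p < i → i < p + m → i ∉ S → i + 1 ∈ S) :
    ∃ e, e + 2 * (Finset.Ico (p + 1) (p + 1 + m) \ S).card =
        m + (if p + m ∈ S then 0 else 1) ∧
      signedSum S m p (p + 1) =
        Polynomial.X ^ (Finset.Ico (p + 1) (p + 1 + m) \ S).card * (1 + Polynomial.X) ^ e := by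
  induction m using Nat.strong_induction_on generalizing p with
  | _ m ih =>
  match m with
  | 0 => exact ⟨0, by simp [hp], by simp [signedSum]⟩
  | m + 1 =>
    by_cases h : p + 1 ∈ S
    · obtain ⟨e, he, hsum⟩ := ih m (by omega) h fun i _ _ => hS i (by omega) (by omega)
      rw [card_Ico_sdiff_of_mem h, show p + 1 + (m + 1) = p + 1 + 1 + m by ring,
        show p + (m + 1) = p + 1 + m by ring]
      refine ⟨e + 1, by omega, ?_⟩
      rw [signedSum_of_mem h, hsum, Nat.add_sub_cancel_left]
      simp only [qt_succ, qt_zero]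
      ring
    · rw [card_Ico_sdiff_of_notMem (by omega) h]
      match m with
      | 0 =>
        refine ⟨0, by simp [h], ?_⟩
        rw [signedSum_one_of_notMem h]
        simp [qt_one]
      | m + 1 =>
        have h' : p + 2 ∈ S := hS (p + 1) (by omega) (by omega) h
        obtain ⟨e, he, hsum⟩ := ih m (by omega) h' fun i _ _ => hS i (by omega) (by omega)
        rw [card_Ico_sdiff_of_mem h', show p + 1 + (m + 1 + 1) = p + 2 + 1 + m by ring,
          show p + (m + 1 + 1) = p + 2 + m by ring]
        refine ⟨e, by omega, ?_⟩
        rw [signedSum_of_notMem_of_mem (by omega) h h', hsum, Nat.add_sub_cancel_left, qt_one]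
        ring

theorem psi_alternating_sum (n : ℕ) (hn : 1 ≤ n) (S : Finset ℕ) (hS : S ⊆ Finset.Icc 1 n) :
    (1 ∉ S →
      ∑ T ∈ (Finset.Icc 1 n).powerset.filter (fun T => S ⊆ T),
          (-1 : Polynomial ℤ) ^ (n - T.card) * psi T = 0) ∧
    ((∃ i, i ∈ Finset.Icc 1 n \ S ∧ i + 1 ∈ Finset.Icc 1 n \ S) →
      ∑ T ∈ (Finset.Icc 1 n).powerset.filter (fun T => S ⊆ T),
          (-1 : Polynomial ℤ) ^ (n - T.card) * psi T = 0) ∧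
    ((∀ i ∈ Finset.Icc 1 n \ S, i + 1 ∉ Finset.Icc 1 n \ S) → 1 ∈ S → n ∈ S →
      ∑ T ∈ (Finset.Icc 1 n).powerset.filter (fun T => S ⊆ T),
          (-1 : Polynomial ℤ) ^ (n - T.card) * psi T =
        Polynomial.X ^ (n - S.card) * (1 + Polynomial.X) ^ (n - 1 - 2 * (n - S.card))) ∧
    ((∀ i ∈ Finset.Icc 1 n \ S, i + 1 ∉ Finset.Icc 1 n \ S) → 1 ∈ S → n ∉ S →
      ∑ T ∈ (Finset.Icc 1 n).powerset.filter (fun T => S ⊆ T),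
          (-1 : Polynomial ℤ) ^ (n - T.card) * psi T =
        Polynomial.X ^ (n - S.card) * (1 + Polynomial.X) ^ (n - 2 * (n - S.card))) := by
  rw [sum_psi_eq_signedSum n S hS]
  obtain ⟨m, rfl⟩ : ∃ m, n = m + 1 := ⟨n - 1, by omega⟩
  have stable (hst : ∀ i ∈ Finset.Icc 1 (m + 1) \ S, i + 1 ∉ Finset.Icc 1 (m + 1) \ S)
      (h1 : 1 ∈ S) : ∃ e, e + 2 * (m + 1 - S.card) = m + (if m + 1 ∈ S then 0 else 1) ∧
        signedSum S (m + 1) 1 1 =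
          Polynomial.X ^ (m + 1 - S.card) * (1 + Polynomial.X) ^ e := by
    have hcard : (Finset.Ico (1 + 1) (1 + 1 + m) \ S).card = m + 1 - S.card := by
      have hI : Finset.Ico 1 (1 + 1 + m) = Finset.Icc 1 (m + 1) := by
        ext x; simp only [Finset.mem_Icc, Finset.mem_Ico]; omega
      rw [← card_Ico_sdiff_of_mem h1, hI, Finset.card_sdiff_of_subset hS, Nat.card_Icc,
        Nat.add_sub_cancel]
    rw [← hcard, signedSum_of_mem h1, Nat.sub_self, zero_add, qt_one, one_mul, add_comm m 1]
    refine signedSum_of_stable h1 fun i hi him hiS => ?_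
    by_contra h
    exact hst i (by simp only [Finset.mem_sdiff, Finset.mem_Icc]; exact ⟨by omega, hiS⟩)
      (by simp only [Finset.mem_sdiff, Finset.mem_Icc]; exact ⟨by omega, h⟩)
  refine ⟨fun h => ?_, ?_, fun hst h1 hn => ?_, fun hst h1 hn => ?_⟩
  · rw [signedSum_of_notMem h, Nat.sub_self, zero_add, qt_one, one_mul, sub_self]
  · rintro ⟨i, hi, hi'⟩
    simp only [Finset.mem_sdiff, Finset.mem_Icc] at hi hi'
    exact signedSum_eq_zero le_rfl hi.1.1 (by omega) hi.2 hi'.2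
  · obtain ⟨e, he, hsum⟩ := stable hst h1
    rw [if_pos hn] at he
    rw [hsum, show m + 1 - 1 - 2 * (m + 1 - S.card) = e by omega]
  · obtain ⟨e, he, hsum⟩ := stable hst h1
    rw [if_neg hn] at he
    rw [hsum, show m + 1 - 2 * (m + 1 - S.card) = e by omega]

end
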